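/- (Discrete maximum principle for the implicit method.) Let u, h : ℤ^d → ℝ be absolutely summable sequences such that u solves one implicit step with data h. Then sup_{α∈ℤ^d} u_α ≤ sup_{α∈ℤ^d} h_α and inf_{α∈ℤ^d} h_α ≤ inf_{α∈ℤ^d} u_α. -/

import Mathlib

open MeasureTheory Set

noncomputable section

abbrev Ed (d : ℕ) := EuclideanSpace ℝ (Fin d)

def cell (d : ℕ) (dx : ℝ) (α : Fin d → ℤ) : Set (Ed d) :=
  {x | ∀ i, dx * (α i : ℝ) < x i ∧ x i < dx * (α i : ℝ) + dx}

def ind (d : ℕ) (S : Set (Ed d)) : Ed d → ℝ :=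
  S.indicator fun _ => 1

def gam (d : ℕ) (dx : ℝ) (μ : Measure (Ed d)) (l : Fin d) : ℝ :=
  - ∫ z in {z : Ed d | dx / 2 < ‖z‖ ∧ ‖z‖ ≤ 1}, z l ∂μ

def Dup (d : ℕ) (dx : ℝ) (μ : Measure (Ed d)) (l : Fin d) (φ : Ed d → ℝ) (x : Ed d) : ℝ :=
  if 0 < gam d dx μ l then (φ (x + EuclideanSpace.single l dx) - φ x) / dx
  else (φ x - φ (x - EuclideanSpace.single l dx)) / dx

def Glow (d : ℕ) (dx : ℝ) (μ : Measure (Ed d)) (α β : Fin d → ℤ) : ℝ :=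
  (dx ^ d)⁻¹ *
    ∫ x in cell d dx α, ∫ z in {z : Ed d | dx / 2 < ‖z‖},
      (ind d (cell d dx β) (x + z) - ind d (cell d dx β) x) ∂μ

def Gup (d : ℕ) (dx : ℝ) (μ : Measure (Ed d)) (α β : Fin d → ℤ) : ℝ :=
  (dx ^ d)⁻¹ *
    ∑ l : Fin d, gam d dx μ l * ∫ x in cell d dx α, Dup d dx μ l (ind d (cell d dx β)) x

def Gw (d : ℕ) (dx : ℝ) (μ : Measure (Ed d)) (α β : Fin d → ℤ) : ℝ :=
  Glow d dx μ α β + Gup d dx μ α β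

def GsplitLow (d : ℕ) (dx r : ℝ) (μ : Measure (Ed d)) (α β : Fin d → ℤ) : ℝ :=
  (dx ^ d)⁻¹ *
    ∫ x in cell d dx α, ∫ z in {z : Ed d | dx / 2 < ‖z‖ ∧ ‖z‖ ≤ r},
      (ind d (cell d dx β) (x + z) - ind d (cell d dx β) x) ∂μ

def GsplitHigh (d : ℕ) (dx r : ℝ) (μ : Measure (Ed d)) (α β : Fin d → ℤ) : ℝ :=
  (dx ^ d)⁻¹ *
      ∫ x in cell d dx α, ∫ z in {z : Ed d | r < ‖z‖},
        (ind d (cell d dx β) (x + z) - ind d (cell d dx β) x) ∂μ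
    + Gup d dx μ α β

def Aok (A : ℝ → ℝ) (LA : ℝ) : Prop :=
  Monotone A ∧ (∀ a b : ℝ, |A a - A b| ≤ LA * |a - b|) ∧ A 0 = 0

def SolvesImplicitStep (d : ℕ) (dx : ℝ) (μ : Measure (Ed d)) (A : ℝ → ℝ) (dt : ℝ)
    (u h : (Fin d → ℤ) → ℝ) : Prop :=
  ∀ α, Summable (fun β => Gw d dx μ α β * A (u β)) ∧
    u α - dt * ∑' β, Gw d dx μ α β * A (u β) = h α

def Fractional (d : ℕ) (μ : Measure (Ed d)) (lam clam : ℝ) : Prop :=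
  ∀ B : Set (Ed d), MeasurableSet B → B ⊆ {z : Ed d | 0 < ‖z‖ ∧ ‖z‖ < 1} →
    μ B ≤ ∫⁻ z in B, ENNReal.ofReal (clam * ‖z‖ ^ (-(d : ℝ) - lam))

def Lhat (d : ℕ) (dx : ℝ) (μ : Measure (Ed d)) (w : Ed d → ℝ) (x : Ed d) : ℝ :=
  (∫ z in {z : Ed d | dx / 2 < ‖z‖}, (w (x + z) - w x) ∂μ) +
    ∑ l : Fin d, gam d dx μ l * Dup d dx μ l w x

def Ubar (d : ℕ) (dx : ℝ) (U : (Fin d → ℤ) → ℝ) (x : Ed d) : ℝ :=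
  ∑' α : Fin d → ℤ, U α * ind d (cell d dx α) x

def cellAvg (d : ℕ) (dx : ℝ) (w : Ed d → ℝ) (x : Ed d) : ℝ :=
  ∑' α : Fin d → ℤ, Set.indicator (cell d dx α)
    (fun _ => (dx ^ d)⁻¹ * ∫ y in cell d dx α, w y) x

lemma iSup_nonneg_of_summable {ι : Type*} [Infinite ι] {f : ι → ℝ} (hf : Summable f)
    (hb : BddAbove (range f)) : 0 ≤ ⨆ i, f i :=
  le_of_tendsto hf.tendsto_cofinite_zero (Filter.Eventually.of_forall fun i => le_ciSup hb i)

lemma Summable.bddAbove_range_of_abs {ι : Type*} {f : ι → ℝ} (hf : Summable fun i => |f i|) :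
    BddAbove (range f) :=
  ⟨∑' i, |f i|, by
    rintro _ ⟨i, rfl⟩
    exact (le_abs_self _).trans (hf.le_tsum i fun j _ => abs_nonneg _)⟩

lemma Summable.exists_isMax_of_pos {ι : Type*} {f : ι → ℝ} (hf : Summable f) {i : ι}
    (hi : 0 < f i) : ∃ j, 0 < f j ∧ ∀ k, f k ≤ f j := by
  have hfin : {k | f i ≤ f k}.Finite := by
    have := hf.tendsto_cofinite_zero.eventually (gt_mem_nhds hi)
    simpa [Filter.eventually_cofinite] using this
  obtain ⟨j, hj, hmax⟩ := hfin.exists_maximalFor f _ ⟨i, le_refl (f i)⟩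
  have hij : f i ≤ f j := hj
  refine ⟨j, hi.trans_le hij, fun k => ?_⟩
  by_contra! hk
  exact absurd (hmax (hij.trans hk.le) hk.le) (not_le.2 hk)

/-- Maximum principle for an implicit step with weights that are nonnegative off the diagonal and
whose finite sums through the diagonal are nonpositive. -/
lemma iSup_le_iSup_of_implicit_step {ι : Type*} [Infinite ι] {G : ι → ι → ℝ}
    (hG : ∀ α β, β ≠ α → 0 ≤ G α β)
    (hGs : ∀ α (F : Finset ι), α ∈ F → ∑ β ∈ F, G α β ≤ 0)
    {A : ℝ → ℝ} (hA : Monotone A) (hA0 : A 0 = 0) {dt : ℝ} (hdt : 0 < dt) {u h : ι → ℝ}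
    (hu : Summable fun α => |u α|) (hh : Summable fun α => |h α|)
    (hstep : ∀ α, Summable (fun β => G α β * A (u β)) ∧
      u α - dt * ∑' β, G α β * A (u β) = h α) :
    (⨆ α, u α) ≤ ⨆ α, h α := by
  classical
  have hbh := hh.bddAbove_range_of_abs
  have hh0 := iSup_nonneg_of_summable hh.of_abs hbh
  refine ciSup_le fun α => ?_
  rcases le_or_gt (u α) 0 with hα | hα
  · exact hα.trans hh0
  obtain ⟨m, hm, hmax⟩ := hu.of_abs.exists_isMax_of_pos hα
  have hAm : 0 ≤ A (u m) := hA0 ▸ hA hm.le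
  have hsum : ∑' β, G m β * A (u β) ≤ 0 := by
    refine le_of_tendsto (hstep m).1.hasSum ?_
    filter_upwards [Filter.eventually_ge_atTop ({m} : Finset ι)] with F hF
    have hmF : m ∈ F := hF (Finset.mem_singleton_self m)
    calc ∑ β ∈ F, G m β * A (u β) ≤ ∑ β ∈ F, G m β * A (u m) := by
          refine Finset.sum_le_sum fun β _ => ?_
          by_cases hβ : β = m
          · rw [hβ]
          · exact mul_le_mul_of_nonneg_left (hA (hmax β)) (hG m β hβ)
      _ = (∑ β ∈ F, G m β) * A (u m) := (Finset.sum_mul _ _ _).symm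
      _ ≤ 0 := mul_nonpos_of_nonpos_of_nonneg (hGs m F hmF) hAm
  have hmul := mul_nonpos_of_nonneg_of_nonpos hdt.le hsum
  calc u α ≤ u m := hmax α
    _ ≤ h m := by linarith [(hstep m).2]
    _ ≤ _ := le_ciSup hbh m

lemma measurableSet_cell (d : ℕ) (dx : ℝ) (α : Fin d → ℤ) : MeasurableSet (cell d dx α) := by
  unfold cell
  measurability

lemma measurable_ind_cell (d : ℕ) (dx : ℝ) (α : Fin d → ℤ) :
    Measurable (ind d (cell d dx α)) :=
  measurable_const.indicator (measurableSet_cell d dx α)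

lemma ind_nonneg (d : ℕ) (S : Set (Ed d)) (x : Ed d) : 0 ≤ ind d S x :=
  indicator_nonneg (fun _ _ => zero_le_one) x

lemma ind_le_one (d : ℕ) (S : Set (Ed d)) (x : Ed d) : ind d S x ≤ 1 :=
  indicator_le_self' (fun _ _ => zero_le_one) x

lemma eq_of_mem_cell {d : ℕ} {dx : ℝ} (hdx : 0 < dx) {α β : Fin d → ℤ} {x : Ed d}
    (hα : x ∈ cell d dx α) (hβ : x ∈ cell d dx β) : α = β := by
  have key : ∀ {α β : Fin d → ℤ}, x ∈ cell d dx α → x ∈ cell d dx β → ∀ i, α i ≤ β i := by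
    intro α β hα hβ i
    have h : dx * (α i : ℝ) < dx * ((β i : ℝ) + 1) := by linarith [(hα i).1, (hβ i).2]
    exact Int.lt_add_one_iff.1 (by exact_mod_cast lt_of_mul_lt_mul_left h hdx.le)
  exact le_antisymm (key hα hβ) (key hβ hα)

lemma ind_cell_eq_zero {d : ℕ} {dx : ℝ} (hdx : 0 < dx) {α β : Fin d → ℤ} {x : Ed d}
    (hx : x ∈ cell d dx α) (h : β ≠ α) : ind d (cell d dx β) x = 0 :=
  indicator_of_notMem (fun hβ => h (eq_of_mem_cell hdx hβ hx)) _

lemma sum_ind_cell_eq_one {d : ℕ} {dx : ℝ} (hdx : 0 < dx) {α : Fin d → ℤ} {x : Ed d}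
    (hx : x ∈ cell d dx α) {F : Finset (Fin d → ℤ)} (hF : α ∈ F) :
    ∑ β ∈ F, ind d (cell d dx β) x = 1 := by
  rw [Finset.sum_eq_single_of_mem α hF fun β _ hβ => ind_cell_eq_zero hdx hx hβ]
  exact indicator_of_mem hx _

lemma sum_ind_cell_le_one {d : ℕ} {dx : ℝ} (hdx : 0 < dx) (F : Finset (Fin d → ℤ)) (x : Ed d) :
    ∑ β ∈ F, ind d (cell d dx β) x ≤ 1 := by
  by_cases h : ∃ α ∈ F, x ∈ cell d dx α
  · obtain ⟨α, hα, hx⟩ := h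
    exact (sum_ind_cell_eq_one hdx hx hα).le
  · push Not at h
    rw [Finset.sum_eq_zero fun β hβ => show ind d (cell d dx β) x = 0 from
      indicator_of_notMem (h β hβ) _]
    exact zero_le_one

lemma abs_ind_sub_ind_le_one (d : ℕ) (S : Set (Ed d)) (x y : Ed d) :
    |ind d S x - ind d S y| ≤ 1 :=
  abs_sub_le_iff.2 ⟨by linarith [ind_le_one d S x, ind_nonneg d S y],
    by linarith [ind_le_one d S y, ind_nonneg d S x]⟩

lemma isFiniteMeasure_restrict_lt_norm {d : ℕ} {μ : Measure (Ed d)}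
    (hμ : ∫⁻ z, ENNReal.ofReal (min (‖z‖ ^ 2) 1) ∂μ < ⊤) {r : ℝ} (hr : 0 < r) :
    IsFiniteMeasure (μ.restrict {z : Ed d | r < ‖z‖}) := by
  rw [isFiniteMeasure_restrict]
  have hc : 0 < min (r ^ 2) 1 := by positivity
  refine ((measure_mono fun z hz => ?_).trans_lt
    ((meas_ge_le_lintegral_div (by fun_prop) (ENNReal.ofReal_pos.2 hc).ne'
      ENNReal.ofReal_ne_top).trans_lt
      (ENNReal.div_lt_top hμ.ne (ENNReal.ofReal_pos.2 hc).ne'))).ne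
  have hz' : r < ‖z‖ := hz
  exact ENNReal.ofReal_le_ofReal (min_le_min_right _ (by gcongr))

lemma isFiniteMeasure_restrict_cell (d : ℕ) (dx : ℝ) (α : Fin d → ℤ) :
    IsFiniteMeasure ((volume : Measure (Ed d)).restrict (cell d dx α)) := by
  rw [isFiniteMeasure_restrict]
  refine ((measure_mono (t := WithLp.ofLp ⁻¹' Icc (fun i => dx * (α i : ℝ))
    fun i => dx * (α i : ℝ) + dx) fun x hx => ?_).trans_lt ?_).ne
  · exact ⟨fun i => (hx i).1.le, fun i => (hx i).2.le⟩
  · rw [(PiLp.volume_preserving_ofLp (Fin d)).measure_preimage measurableSet_Icc.nullMeasurableSet]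
    exact measure_Icc_lt_top

lemma integrable_ind_sub_ind {d : ℕ} {ν : Measure (Ed d)} [IsFiniteMeasure ν] (dx : ℝ)
    (β : Fin d → ℤ) {f g : Ed d → Ed d} (hf : Measurable f) (hg : Measurable g) :
    Integrable (fun x => ind d (cell d dx β) (f x) - ind d (cell d dx β) (g x)) ν :=
  Integrable.of_bound (((measurable_ind_cell d dx β).comp hf).sub
      ((measurable_ind_cell d dx β).comp hg)).aestronglyMeasurable 1
    (Filter.Eventually.of_forall fun _ => abs_ind_sub_ind_le_one _ _ _ _)

lemma integrable_integral_ind_sub_ind {d : ℕ} {ν ρ : Measure (Ed d)} [IsFiniteMeasure ν]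
    [IsFiniteMeasure ρ] (dx : ℝ) (β : Fin d → ℤ) :
    Integrable (fun x => ∫ z, (ind d (cell d dx β) (x + z) - ind d (cell d dx β) x) ∂ν) ρ := by
  have hm := measurable_ind_cell d dx β
  have hmeas : Measurable fun p : Ed d × Ed d =>
      ind d (cell d dx β) (p.1 + p.2) - ind d (cell d dx β) p.1 :=
    (hm.comp (measurable_fst.add measurable_snd)).sub (hm.comp measurable_fst)
  refine Integrable.of_bound
    hmeas.stronglyMeasurable.integral_prod_right'.aestronglyMeasurable (1 * ν.real univ)
    (Filter.Eventually.of_forall fun x => norm_integral_le_of_norm_le_const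
      (Filter.Eventually.of_forall fun z => abs_ind_sub_ind_le_one _ _ _ _))

lemma integrable_Dup {d : ℕ} {ρ : Measure (Ed d)} [IsFiniteMeasure ρ] (dx : ℝ)
    (μ : Measure (Ed d)) (l : Fin d) (β : Fin d → ℤ) :
    Integrable (Dup d dx μ l (ind d (cell d dx β))) ρ := by
  unfold Dup
  split_ifs
  · exact (integrable_ind_sub_ind dx β (by fun_prop) measurable_id).div_const dx
  · exact (integrable_ind_sub_ind dx β measurable_id (by fun_prop)).div_const dx

lemma Glow_nonneg {d : ℕ} {dx : ℝ} (hdx : 0 < dx) (μ : Measure (Ed d)) {α β : Fin d → ℤ}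
    (h : β ≠ α) : 0 ≤ Glow d dx μ α β := by
  refine mul_nonneg (by positivity) (setIntegral_nonneg (measurableSet_cell d dx α) fun x hx => ?_)
  refine integral_nonneg fun z => ?_
  simpa [ind_cell_eq_zero hdx hx h] using ind_nonneg d (cell d dx β) (x + z)

lemma Gup_nonneg {d : ℕ} {dx : ℝ} (hdx : 0 < dx) (μ : Measure (Ed d)) {α β : Fin d → ℤ}
    (h : β ≠ α) : 0 ≤ Gup d dx μ α β := by
  refine mul_nonneg (by positivity) (Finset.sum_nonneg fun l _ => ?_)
  have hcell := measurableSet_cell d dx α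
  by_cases hg : 0 < gam d dx μ l
  · refine mul_nonneg hg.le (setIntegral_nonneg hcell fun x hx => ?_)
    rw [Dup, if_pos hg, ind_cell_eq_zero hdx hx h, sub_zero]
    exact div_nonneg (ind_nonneg _ _ _) hdx.le
  · refine mul_nonneg_of_nonpos_of_nonpos (not_lt.1 hg) (setIntegral_nonpos hcell fun x hx => ?_)
    rw [Dup, if_neg hg, ind_cell_eq_zero hdx hx h, zero_sub]
    exact div_nonpos_of_nonpos_of_nonneg (neg_nonpos.2 (ind_nonneg _ _ _)) hdx.le

lemma sum_Glow_nonpos {d : ℕ} {dx : ℝ} (hdx : 0 < dx) {μ : Measure (Ed d)}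
    (hμ : ∫⁻ z, ENNReal.ofReal (min (‖z‖ ^ 2) 1) ∂μ < ⊤) {α : Fin d → ℤ}
    {F : Finset (Fin d → ℤ)} (hF : α ∈ F) : ∑ β ∈ F, Glow d dx μ α β ≤ 0 := by
  have := isFiniteMeasure_restrict_lt_norm hμ (half_pos hdx)
  have := isFiniteMeasure_restrict_cell d dx α
  unfold Glow
  rw [← Finset.mul_sum, ← integral_finsetSum _ fun β _ => integrable_integral_ind_sub_ind dx β]
  refine mul_nonpos_of_nonneg_of_nonpos (by positivity)
    (setIntegral_nonpos (measurableSet_cell d dx α) fun x hx => ?_)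
  rw [← integral_finsetSum _ fun β _ =>
    integrable_ind_sub_ind dx β (by fun_prop) measurable_const]
  refine integral_nonpos fun z => ?_
  simp only [Finset.sum_sub_distrib, sum_ind_cell_eq_one hdx hx hF]
  exact sub_nonpos.2 (sum_ind_cell_le_one hdx F _)

lemma sum_Gup_nonpos {d : ℕ} {dx : ℝ} (hdx : 0 < dx) (μ : Measure (Ed d)) {α : Fin d → ℤ}
    {F : Finset (Fin d → ℤ)} (hF : α ∈ F) : ∑ β ∈ F, Gup d dx μ α β ≤ 0 := by
  have := isFiniteMeasure_restrict_cell d dx α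
  have hcell := measurableSet_cell d dx α
  unfold Gup
  rw [← Finset.mul_sum, Finset.sum_comm]
  refine mul_nonpos_of_nonneg_of_nonpos (by positivity) (Finset.sum_nonpos fun l _ => ?_)
  rw [← Finset.mul_sum, ← integral_finsetSum _ fun β _ => integrable_Dup dx μ l β]
  by_cases hg : 0 < gam d dx μ l
  · refine mul_nonpos_of_nonneg_of_nonpos hg.le (setIntegral_nonpos hcell fun x hx => ?_)
    simp only [Dup, if_pos hg, ← Finset.sum_div, Finset.sum_sub_distrib,
      sum_ind_cell_eq_one hdx hx hF]
    exact div_nonpos_of_nonpos_of_nonneg (sub_nonpos.2 (sum_ind_cell_le_one hdx F _)) hdx.le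
  · refine mul_nonpos_of_nonpos_of_nonneg (not_lt.1 hg) (setIntegral_nonneg hcell fun x hx => ?_)
    simp only [Dup, if_neg hg, ← Finset.sum_div, Finset.sum_sub_distrib,
      sum_ind_cell_eq_one hdx hx hF]
    exact div_nonneg (sub_nonneg.2 (sum_ind_cell_le_one hdx F _)) hdx.le

theorem stmt13 (d : ℕ) (hd : 1 ≤ d) (dx : ℝ) (hdx0 : 0 < dx) (hdx1 : dx < 1)
    (μ : Measure (Ed d)) (hμ0 : μ {0} = 0)
    (hμfin : ∫⁻ z, ENNReal.ofReal (min (‖z‖ ^ 2) 1) ∂μ < ⊤)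
    (A : ℝ → ℝ) (LA : ℝ) (hA : Aok A LA) (dt : ℝ) (hdt : 0 < dt)
    (u h : (Fin d → ℤ) → ℝ)
    (hu : Summable fun α => |u α|) (hh : Summable fun α => |h α|)
    (hstep : SolvesImplicitStep d dx μ A dt u h) :
    (⨆ α : Fin d → ℤ, u α) ≤ (⨆ α : Fin d → ℤ, h α) ∧
    (⨅ α : Fin d → ℤ, h α) ≤ (⨅ α : Fin d → ℤ, u α) := by
  have : Nonempty (Fin d) := ⟨⟨0, hd⟩⟩
  have hG : ∀ α β, β ≠ α → 0 ≤ Gw d dx μ α β := fun α β hβ =>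
    add_nonneg (Glow_nonneg hdx0 μ hβ) (Gup_nonneg hdx0 μ hβ)
  have hGs : ∀ α (F : Finset (Fin d → ℤ)), α ∈ F → ∑ β ∈ F, Gw d dx μ α β ≤ 0 := by
    intro α F hF
    simp only [Gw, Finset.sum_add_distrib]
    exact add_nonpos (sum_Glow_nonpos hdx0 hμfin hF) (sum_Gup_nonpos hdx0 μ hF)
  obtain ⟨hmono, -, hA0⟩ := hA
  refine ⟨iSup_le_iSup_of_implicit_step hG hGs hmono hA0 hdt hu hh hstep, ?_⟩
  have hneg := iSup_le_iSup_of_implicit_step hG hGs (A := fun x => -A (-x))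
    (fun a b hab => neg_le_neg (hmono (neg_le_neg hab))) (by simp [hA0]) hdt
    (u := fun α => -u α) (h := fun α => -h α) (by simpa using hu) (by simpa using hh)
    (fun α => by
      obtain ⟨hs, he⟩ := hstep α
      simp only [neg_neg, mul_neg, tsum_neg]
      exact ⟨hs.neg, by linarith⟩)
  have hbu : BddAbove (range fun α => -u α) :=
    Summable.bddAbove_range_of_abs (by simpa using hu)
  have hbh : BddBelow (range h) := by
    obtain ⟨c, hc⟩ := Summable.bddAbove_range_of_abs (f := fun α => -h α) (by simpa using hh)
    refine ⟨-c, ?_⟩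
    rintro _ ⟨α, rfl⟩
    exact neg_le.1 (hc ⟨α, rfl⟩)
  have hle : (⨆ α, -h α) ≤ -⨅ α, h α := ciSup_le fun α => neg_le_neg (ciInf_le hbh α)
  exact le_ciInf fun α => neg_le_neg_iff.1 ((le_ciSup hbu α).trans (hneg.trans hle))
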